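/- Suppose β_{1,t} ≤ β₁ < 1 for all t, the sequence β_{1,t} is non-increasing, and ‖α_i m_i/√v̂_i‖ ≤ G almost surely for all i. Then E[∑_{i=1}^{t} ‖(β_{1,i+1}/(1−β_{1,i+1}) − β_{1,i}/(1−β_{1,i})) α_i m_i/√v̂_i‖²] ≤ (β₁/(1−β₁) − β_{1,t+1}/(1−β_{1,t+1}))² · G². -/

import Mathlib

open MeasureTheory Finset ProbabilityTheory

/-- The vector `a/√v ∈ ℝ^d` (elementwise). -/
noncomputable def stepVec {d : ℕ} (a : ℝ) (v : EuclideanSpace ℝ (Fin d)) :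
    EuclideanSpace ℝ (Fin d) :=
  (EuclideanSpace.equiv (Fin d) ℝ).symm fun j => a / Real.sqrt (v j)

/-- Elementwise (Hadamard) product `x ⊙ y`. -/
noncomputable def hadamardVec {d : ℕ} (x y : EuclideanSpace ℝ (Fin d)) :
    EuclideanSpace ℝ (Fin d) :=
  (EuclideanSpace.equiv (Fin d) ℝ).symm fun j => x j * y j

/-- For a sequence that is non-increasing from index `1` on, the sum of squared increments is at most
the square of the total decrease. -/
theorem sum_sq_sub_le_sq_sub {u : ℕ → ℝ} (hu : ∀ i, 1 ≤ i → u (i + 1) ≤ u i) (t : ℕ) :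
    u (t + 1) ≤ u 1 ∧
      ∑ i ∈ Finset.Icc 1 t, (u (i + 1) - u i) ^ 2 ≤ (u 1 - u (t + 1)) ^ 2 := by
  induction t with
  | zero => simp
  | succ n ih =>
    obtain ⟨hle, hsum⟩ := ih
    have hstep := hu (n + 1) (by omega)
    rw [Finset.sum_Icc_succ_top (by omega)]
    refine ⟨hstep.trans hle, ?_⟩
    nlinarith [mul_nonneg (sub_nonneg.2 hle) (sub_nonneg.2 hstep)]

/-- The map `b ↦ b / (1 - b)` is monotone on `(-∞, 1)`. -/
theorem div_one_sub_le_div_one_sub {a b : ℝ} (hab : a ≤ b) (hb : b < 1) :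
    a / (1 - a) ≤ b / (1 - b) := by
  rw [div_le_div_iff₀ (by linarith) (by linarith)]
  linarith

/-- Lemma A.5 of the paper: bound on the term `T4`:
`E[∑_{i=1}^t ‖(β_{1,i+1}/(1-β_{1,i+1}) - β_{1,i}/(1-β_{1,i})) α_i m_i/√v̂_i‖²]
  ≤ (β₁/(1-β₁) - β_{1,t+1}/(1-β_{1,t+1}))² G²`. -/
theorem generalized_adam_T4_bound
    {d : ℕ} (hd : 1 ≤ d)
    {Ω : Type} [MeasurableSpace Ω] (μ : Measure Ω) [IsProbabilityMeasure μ]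
    (α β1 : ℕ → ℝ) (β₁ : ℝ)
    (hα : ∀ t, 1 ≤ t → 0 < α t)
    (hβ : ∀ t, 1 ≤ t → 0 ≤ β1 t ∧ β1 t < 1)
    (hβub : ∀ t, 1 ≤ t → β1 t ≤ β₁) (hβ₁ : β₁ < 1)
    (hβmono : ∀ t, 1 ≤ t → β1 (t + 1) ≤ β1 t)
    (g vhat m x : ℕ → Ω → EuclideanSpace ℝ (Fin d))
    (hgmeas : ∀ t, Measurable (g t))
    (hvfun : ∀ t, 1 ≤ t →
      ∃ h : (Fin t → EuclideanSpace ℝ (Fin d)) → EuclideanSpace ℝ (Fin d),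
        Measurable h ∧ ∀ ω, vhat t ω = h fun i => g (i + 1) ω)
    (hvpos : ∀ t, 1 ≤ t → ∀ ω, ∀ j, 0 < vhat t ω j)
    (hm0 : ∀ ω, m 0 ω = 0)
    (hm : ∀ t, 1 ≤ t → ∀ ω, m t ω = β1 t • m (t - 1) ω + (1 - β1 t) • g t ω)
    (x1 : EuclideanSpace ℝ (Fin d)) (hx1 : ∀ ω, x 1 ω = x1)
    (hx : ∀ t, 1 ≤ t → ∀ ω,
      x (t + 1) ω = x t ω - hadamardVec (stepVec (α t) (vhat t ω)) (m t ω))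
    (G : ℝ)
    (hG : ∀ i, 1 ≤ i → ∀ᵐ ω ∂μ,
      ‖hadamardVec (stepVec (α i) (vhat i ω)) (m i ω)‖ ≤ G)
    (t : ℕ) (ht : 1 ≤ t)
    (hint : Integrable (fun ω => ∑ i ∈ Finset.Icc 1 t,
      ‖(β1 (i + 1) / (1 - β1 (i + 1)) - β1 i / (1 - β1 i)) •
        hadamardVec (stepVec (α i) (vhat i ω)) (m i ω)‖ ^ 2) μ) :
    (∫ ω, (∑ i ∈ Finset.Icc 1 t,
        ‖(β1 (i + 1) / (1 - β1 (i + 1)) - β1 i / (1 - β1 i)) •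
          hadamardVec (stepVec (α i) (vhat i ω)) (m i ω)‖ ^ 2) ∂μ)
      ≤ (β₁ / (1 - β₁) - β1 (t + 1) / (1 - β1 (t + 1))) ^ 2 * G ^ 2 := by
  have hu : ∀ i, 1 ≤ i → β1 (i + 1) / (1 - β1 (i + 1)) ≤ β1 i / (1 - β1 i) := fun i hi =>
    div_one_sub_le_div_one_sub (hβmono i hi) (hβ i hi).2
  obtain ⟨hle, hsum⟩ := sum_sq_sub_le_sq_sub (u := fun i => β1 i / (1 - β1 i)) hu t
  have htop := div_one_sub_le_div_one_sub (hβub 1 le_rfl) hβ₁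
  have hG' : ∀ᵐ ω ∂μ, ∀ i, 1 ≤ i →
      ‖hadamardVec (stepVec (α i) (vhat i ω)) (m i ω)‖ ≤ G :=
    ae_all_iff.2 fun i => Filter.eventually_imp_distrib_left.2 (hG i)
  refine (integral_mono_ae hint (integrable_const _) ?_).trans_eq
    (integral_const _ |>.trans (by rw [probReal_univ, one_smul]))
  filter_upwards [hG'] with ω hω
  calc _ ≤ ∑ i ∈ Finset.Icc 1 t,
        (β1 (i + 1) / (1 - β1 (i + 1)) - β1 i / (1 - β1 i)) ^ 2 * G ^ 2 := by
        refine Finset.sum_le_sum fun i hi => ?_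
        rw [norm_smul, mul_pow, Real.norm_eq_abs, sq_abs]
        gcongr
        exact hω i (Finset.mem_Icc.1 hi).1
    _ ≤ _ := by
        rw [← Finset.sum_mul]
        gcongr
        exact hsum.trans (pow_le_pow_left₀ (sub_nonneg.2 hle) (by linarith) 2)
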